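/- Capture-avoiding simultaneous substitution for the simply-typed lambda calculus satisfies the monad laws: for all typed contexts V, W, Z, all substitutions f : ∀ t, V t → TLC W t and g : ∀ t, W t → TLC Z t, all types t and all x : V t, M : TLC V t, one has (1) bind f t (Var x) = f t x, (2) bind Var t M = M, and (3) bind g t (bind f t M) = bind (fun t x => bind g t (f t x)) t M. -/

import Mathlib

/-- Simple types: a base type and a binary arrow. -/
inductive Ty : Type
  | base : Ty
  | arrow : Ty → Ty → Ty

/-- The context `V` extended by one fresh variable of type `s`. -/
def ext (V : Ty → Type) (s : Ty) : Ty → Type :=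
  fun t => Sum (V t) (PLift (s = t))

/-- Simply-typed lambda terms over a typed context. -/
inductive TLC : (Ty → Type) → Ty → Type 1
  | Var : ∀ {V : Ty → Type} (t : Ty), V t → TLC V t
  | Abs : ∀ {V : Ty → Type} (s t : Ty), TLC (ext V s) t → TLC V (Ty.arrow s t)
  | App : ∀ {V : Ty → Type} (s t : Ty), TLC V (Ty.arrow s t) → TLC V s → TLC V t

/-- Action of a context morphism on an extended context. -/
def extMap {V W : Ty → Type} (f : ∀ t, V t → W t) (s : Ty) :
    ∀ t, ext V s t → ext W s t := fun t x =>
  match x with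
  | .inl v => .inl (f t v)
  | .inr h => .inr h

/-- Renaming (functoriality in the context). -/
def rename : ∀ {V W : Ty → Type}, (∀ t, V t → W t) → ∀ t, TLC V t → TLC W t
  | _, _, f, _, .Var t x => .Var t (f t x)
  | _, _, f, _, .Abs s t M => .Abs s t (rename (extMap f s) t M)
  | _, _, f, _, .App s t M N => .App s t (rename f _ M) (rename f s N)

/-- Lifting of a substitution under a binder of type `s`: the fresh variable is
sent to itself and every other variable `x` to the weakening of `f x`. -/
def lift {V W : Ty → Type} (f : ∀ t, V t → TLC W t) (s : Ty) :
    ∀ t, ext V s t → TLC (ext W s) t := fun t x =>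
  match x with
  | .inl v => rename (fun _ w => Sum.inl w) t (f t v)
  | .inr h => .Var t (Sum.inr h)

/-- Capture-avoiding simultaneous substitution. -/
def bind : ∀ {V W : Ty → Type}, (∀ t, V t → TLC W t) → ∀ t, TLC V t → TLC W t
  | _, _, f, _, .Var t x => f t x
  | _, _, f, _, .Abs s t M => .Abs s t (bind (lift f s) t M)
  | _, _, f, _, .App s t M N => .App s t (bind f _ M) (bind f s N)

/-- Substitution of a single (the fresh) variable: `M[∗ := N]`. -/
def subst1 {V : Ty → Type} {s t : Ty} (M : TLC (ext V s) t) (N : TLC V s) :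
    TLC V t :=
  bind (fun u x =>
    match x with
    | .inl v => .Var u v
    | .inr h => h.down ▸ N) t M

/-- One-step beta reduction, with congruence closure. -/
inductive Beta : ∀ {V : Ty → Type} {t : Ty}, TLC V t → TLC V t → Prop
  | beta {V : Ty → Type} {s t : Ty} (M : TLC (ext V s) t) (N : TLC V s) :
      Beta (.App s t (.Abs s t M) N) (subst1 M N)
  | absCong {V : Ty → Type} {s t : Ty} {M M' : TLC (ext V s) t} :
      Beta M M' → Beta (.Abs s t M) (.Abs s t M')
  | appL {V : Ty → Type} {s t : Ty} {M M' : TLC V (Ty.arrow s t)} {N : TLC V s} :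
      Beta M M' → Beta (.App s t M N) (.App s t M' N)
  | appR {V : Ty → Type} {s t : Ty} {M : TLC V (Ty.arrow s t)} {N N' : TLC V s} :
      Beta N N' → Beta (.App s t M N) (.App s t M N')

/-- `β*`: the reflexive–transitive closure of one-step beta reduction. -/
def BetaStar {V : Ty → Type} {t : Ty} : TLC V t → TLC V t → Prop :=
  Relation.ReflTransGen Beta

/-- The weakening renaming. -/
def wkn (V : Ty → Type) (s : Ty) : ∀ t, V t → ext V s t := fun _ w => Sum.inl w

theorem rename_rename_aux {V : Ty → Type} {t : Ty} (M : TLC V t) :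
    ∀ {W Z : Ty → Type} (f : ∀ t, V t → W t) (g : ∀ t, W t → Z t) (h : ∀ t, V t → Z t),
      (∀ t x, g t (f t x) = h t x) → rename g t (rename f t M) = rename h t M := by
  induction M with
  | Var t x => intro W Z f g h e; simp only [rename, e]
  | Abs s t M ih =>
    intro W Z f g h e
    simp only [rename]
    rw [ih _ _ (extMap h s)]
    rintro t (x | x)
    · exact congrArg Sum.inl (e _ _)
    · rfl
  | App s t M N ihM ihN =>
    intro W Z f g h e
    simp only [rename]
    rw [ihM _ _ h e, ihN _ _ h e]

theorem bind_rename_aux {V : Ty → Type} {t : Ty} (M : TLC V t) :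
    ∀ {W Z : Ty → Type} (f : ∀ t, V t → W t) (g : ∀ t, W t → TLC Z t) (h : ∀ t, V t → TLC Z t),
      (∀ t x, g t (f t x) = h t x) → bind g t (rename f t M) = bind h t M := by
  induction M with
  | Var t x => intro W Z f g h e; simp only [rename, _root_.bind, e]
  | Abs s t M ih =>
    intro W Z f g h e
    simp only [rename, _root_.bind]
    rw [ih _ _ (lift h s)]
    rintro t (x | x)
    · exact congrArg (rename (wkn Z s) t) (e t x)
    · rfl
  | App s t M N ihM ihN =>
    intro W Z f g h e
    simp only [rename, _root_.bind]
    rw [ihM _ _ h e, ihN _ _ h e]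

theorem rename_bind_aux {V : Ty → Type} {t : Ty} (M : TLC V t) :
    ∀ {W Z : Ty → Type} (f : ∀ t, V t → TLC W t) (g : ∀ t, W t → Z t) (h : ∀ t, V t → TLC Z t),
      (∀ t x, rename g t (f t x) = h t x) → rename g t (bind f t M) = bind h t M := by
  induction M with
  | Var t x => intro W Z f g h e; simp only [_root_.bind, e]
  | Abs s t M ih =>
    intro W Z f g h e
    simp only [rename, _root_.bind]
    rw [ih _ _ (lift h s)]
    rintro t (x | x)
    · change rename (extMap g s) t (rename (wkn W s) t (f t x)) = rename (wkn Z s) t (h t x)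
      rw [← e, rename_rename_aux _ _ _ (fun t x => wkn Z s t (g t x)) (fun _ _ => rfl)]
      exact rename_rename_aux _ _ _ _ (fun _ _ => rfl)
    · simp only [lift, rename, extMap]
  | App s t M N ihM ihN =>
    intro W Z f g h e
    simp only [rename, _root_.bind]
    rw [ihM _ _ h e, ihN _ _ h e]

theorem bind_bind_aux {V : Ty → Type} {t : Ty} (M : TLC V t) :
    ∀ {W Z : Ty → Type} (f : ∀ t, V t → TLC W t) (g : ∀ t, W t → TLC Z t)
      (h : ∀ t, V t → TLC Z t),
      (∀ t x, bind g t (f t x) = h t x) → bind g t (bind f t M) = bind h t M := by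
  induction M with
  | Var t x => intro W Z f g h e; simp only [_root_.bind, e]
  | Abs s t M ih =>
    intro W Z f g h e
    simp only [_root_.bind]
    rw [ih _ _ (lift h s)]
    rintro t (x | x)
    · change bind (lift g s) t (rename (wkn W s) t (f t x)) = rename (wkn Z s) t (h t x)
      rw [← e, bind_rename_aux _ _ _ (fun t x => rename (wkn Z s) t (g t x)) (fun _ _ => rfl),
        rename_bind_aux _ _ _ (fun t x => rename (wkn Z s) t (g t x)) (fun _ _ => rfl)]
    · simp only [lift, _root_.bind]
  | App s t M N ihM ihN =>
    intro W Z f g h e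
    simp only [_root_.bind]
    rw [ihM _ _ h e, ihN _ _ h e]

theorem bind_var_aux {V : Ty → Type} {t : Ty} (M : TLC V t) :
    ∀ (f : ∀ t, V t → TLC V t), (∀ t x, f t x = TLC.Var t x) → bind f t M = M := by
  induction M with
  | Var t x => intro f e; simp only [_root_.bind, e]
  | Abs s t M ih =>
    intro f e
    simp only [_root_.bind]
    rw [ih]
    rintro t (x | x)
    · change rename (wkn _ s) t (f t x) = TLC.Var t (wkn _ s t x)
      rw [e]
      simp only [rename]
    · rfl
  | App s t M N ihM ihN =>
    intro f e
    simp only [_root_.bind]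
    rw [ihM _ e, ihN _ e]

theorem tlc_bind_monad_laws :
    (∀ (V W : Ty → Type) (f : ∀ t, V t → TLC W t) (t : Ty) (x : V t),
        bind f t (TLC.Var t x) = f t x) ∧
    (∀ (V : Ty → Type) (t : Ty) (M : TLC V t),
        bind (@TLC.Var V) t M = M) ∧
    (∀ (V W Z : Ty → Type) (f : ∀ t, V t → TLC W t) (g : ∀ t, W t → TLC Z t)
        (t : Ty) (M : TLC V t),
        bind g t (bind f t M) = bind (fun t x => bind g t (f t x)) t M) := by
  refine ⟨fun V W f t x => ?_, fun V t M => bind_var_aux M _ (fun _ _ => rfl),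
    fun V W Z f g t M => bind_bind_aux M f g _ (fun _ _ => rfl)⟩
  simp only [_root_.bind]
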